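/- Let N ≥ 2 be an integer, g, h, u_m, α₂, …, α_N real numbers, and α₁ a nonzero real number, and assume gh > Σ_{i=2}^N α_i²/(2i+1). Then the matrix A^{MHSWME} has N+2 pairwise distinct real eigenvalues, namely the numbers u_m + α₁·r for each of the N real roots r of P'_{N+1}, together with u_m ± √(gh + α₁² − Σ_{i=2}^N α_i²/(2i+1)); in particular, A^{MHSWME} is diagonalizable over ℝ. -/

import Mathlib

open Polynomial

/-- The Legendre polynomial of degree `n` (Rodrigues' formula), normalized so `P n 1 = 1`. -/
noncomputable def legendre (n : ℕ) : Polynomial ℝ :=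
  ((2 ^ n * n.factorial : ℝ))⁻¹ • (derivative^[n] ((X ^ 2 - 1) ^ n))

/-- Entry `(i,j)` (0-based) of the tridiagonal matrix `A₂`. -/
noncomputable def A2entry (α1 : ℝ) (i j : ℕ) : ℝ :=
  if j = i + 1 then ((i : ℝ) + 3) / (2 * (i : ℝ) + 5) * α1
  else if i = j + 1 then ((j : ℝ) + 1) / (2 * (j : ℝ) + 3) * α1
  else 0

/-- The MHSWME system matrix in convective variables. -/
noncomputable def AMHSWME (N : ℕ) (g h um : ℝ) (α : ℕ → ℝ) :
    Matrix (Fin (N + 2)) (Fin (N + 2)) ℝ := fun r c =>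
  if r.val = 0 then (if c.val = 1 then 1 else 0)
  else if r.val = 1 then
    (if c.val = 0 then g * h - um ^ 2 - ∑ j ∈ Finset.Icc 1 N, (α j) ^ 2 / (2 * (j : ℝ) + 1)
     else if c.val = 1 then 2 * um
     else 2 / (2 * (c.val : ℝ) - 1) * α (c.val - 1))
  else if c.val = 0 then
    (if r.val = 2 then -2 * um * α 1 else if r.val = 3 then -(2 / 3) * (α 1) ^ 2 else 0)
  else if c.val = 1 then (if r.val = 2 then 2 * α 1 else 0)
  else (if r = c then um else 0) + A2entry (α 1) (r.val - 2) (c.val - 2)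

/-- Rolle's theorem for a finite set of roots of a real polynomial. -/
theorem exists_finset_roots_derivative {p : ℝ[X]} {a b : ℝ} (s : Finset ℝ)
    (hs : ∀ x ∈ s, x ∈ Set.Icc a b ∧ p.eval x = 0) :
    ∃ t : Finset ℝ, s.card ≤ t.card + 1 ∧
      ∀ x ∈ t, x ∈ Set.Ioo a b ∧ (derivative p).eval x = 0 := by
  rcases hm : s.card with _ | m
  · exact ⟨∅, by simp, by simp⟩
  let f := s.orderEmbOfFin hm
  have hfs : ∀ i, f i ∈ s := fun i => s.orderEmbOfFin_mem hm i
  have key : ∀ i : Fin m, ∃ c ∈ Set.Ioo (f i.castSucc) (f i.succ), (derivative p).eval c = 0 := by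
    intro i
    refine exists_hasDerivAt_eq_zero (f := fun x => p.eval x)
      (f.strictMono i.castSucc_lt_succ) p.continuous.continuousOn ?_ fun x _ => p.hasDerivAt x
    rw [(hs _ (hfs _)).2, (hs _ (hfs _)).2]
  choose c hc hc0 using key
  have hmono : StrictMono c := fun i j hij =>
    (hc i).2.trans_le ((f.monotone (Fin.succ_le_castSucc_iff.2 hij)).trans (hc j).1.le)
  refine ⟨Finset.univ.image c, ?_, ?_⟩
  · rw [Finset.card_image_of_injective _ hmono.injective]
    simp
  · intro x hx
    obtain ⟨i, -, rfl⟩ := Finset.mem_image.1 hx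
    exact ⟨⟨(hs _ (hfs _)).1.1.trans_lt (hc i).1, (hc i).2.trans_le (hs _ (hfs _)).1.2⟩, hc0 i⟩

theorem eval_iterate_derivative_sq_sub_one_pow {n k : ℕ} (hk : k < n) {x : ℝ} (hx : x ^ 2 = 1) :
    (derivative^[k] ((X ^ 2 - 1 : ℝ[X]) ^ n)).eval x = 0 := by
  obtain ⟨q, hq⟩ := pow_sub_dvd_iterate_derivative_pow (X ^ 2 - 1 : ℝ[X]) n k
  rw [hq]
  simp [hx, Nat.sub_ne_zero_of_lt hk]

theorem exists_roots_iterate_derivative_sq_sub_one_pow (n k : ℕ) (hk : k ≤ n) :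
    ∃ t : Finset ℝ, k ≤ t.card ∧ ∀ x ∈ t, x ∈ Set.Ioo (-1 : ℝ) 1 ∧
      (derivative^[k] ((X ^ 2 - 1 : ℝ[X]) ^ n)).eval x = 0 := by
  induction k with
  | zero => exact ⟨∅, by simp, by simp⟩
  | succ k ih =>
    obtain ⟨t, htc, ht⟩ := ih (by omega)
    have h1 : (1 : ℝ) ∉ t := fun h => absurd (ht _ h).1.2 (lt_irrefl _)
    have h2 : (-1 : ℝ) ∉ insert 1 t := by
      rw [Finset.mem_insert]
      rintro (h | h)
      · norm_num at h
      · exact lt_irrefl _ (ht _ h).1.1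
    obtain ⟨u, huc, hu⟩ := exists_finset_roots_derivative
      (p := derivative^[k] ((X ^ 2 - 1 : ℝ[X]) ^ n)) (a := -1) (b := 1)
      (insert (-1) (insert 1 t)) (by
        intro x hx
        simp only [Finset.mem_insert] at hx
        rcases hx with rfl | rfl | hx
        · exact ⟨by norm_num, eval_iterate_derivative_sq_sub_one_pow (by omega) (by norm_num)⟩
        · exact ⟨by norm_num, eval_iterate_derivative_sq_sub_one_pow (by omega) (by norm_num)⟩
        · exact ⟨Set.Ioo_subset_Icc_self (ht x hx).1, (ht x hx).2⟩)
    rw [Finset.card_insert_of_notMem h2, Finset.card_insert_of_notMem h1] at huc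
    refine ⟨u, by omega, fun x hx => ⟨(hu x hx).1, ?_⟩⟩
    rw [Function.iterate_succ_apply']
    exact (hu x hx).2

theorem derivative_legendre (n : ℕ) :
    derivative (legendre n) =
      ((2 ^ n * n.factorial : ℝ))⁻¹ • derivative^[n + 1] ((X ^ 2 - 1) ^ n) := by
  rw [legendre, derivative_smul, Function.iterate_succ_apply']

theorem exists_roots_derivative_legendre (n : ℕ) :
    ∃ t : Finset ℝ, t.card = n ∧ ∀ x ∈ t, x ∈ Set.Ioo (-1 : ℝ) 1 ∧
      (derivative (legendre (n + 1))).eval x = 0 := by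
  obtain ⟨t, htc, ht⟩ := exists_roots_iterate_derivative_sq_sub_one_pow (n + 1) (n + 1) le_rfl
  obtain ⟨u, huc, hu⟩ := exists_finset_roots_derivative t
    fun x hx => ⟨Set.Ioo_subset_Icc_self (ht x hx).1, (ht x hx).2⟩
  obtain ⟨v, hvu, hvc⟩ := Finset.exists_subset_card_eq (show n ≤ u.card by omega)
  refine ⟨v, hvc, fun x hx => ⟨(hu x (hvu hx)).1, ?_⟩⟩
  rw [derivative_legendre, eval_smul, Function.iterate_succ_apply', (hu x (hvu hx)).2, smul_zero]

theorem derivative_sq_sub_one_pow_succ (n : ℕ) :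
    derivative ((X ^ 2 - 1 : ℝ[X]) ^ (n + 1)) =
      (2 * ((n : ℝ) + 1)) • ((X ^ 2 - 1) ^ n * X) := by
  rw [derivative_pow_succ]
  simp only [derivative_sub, derivative_X_sq, derivative_one, smul_eq_C_mul, map_mul, map_add]
  simp
  ring

theorem derivative_derivative_sq_sub_one_pow (n : ℕ) :
    derivative (derivative ((X ^ 2 - 1 : ℝ[X]) ^ (n + 2))) =
      (2 * ((n : ℝ) + 2) * (2 * n + 3)) • (X ^ 2 - 1 : ℝ[X]) ^ (n + 1) +
        (4 * ((n : ℝ) + 1) * (n + 2)) • (X ^ 2 - 1 : ℝ[X]) ^ n := by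
  rw [derivative_sq_sub_one_pow_succ, derivative_smul, derivative_mul,
    derivative_sq_sub_one_pow_succ]
  simp only [smul_eq_C_mul, map_mul, map_add, derivative_X, map_natCast, map_one, map_ofNat]
  push_cast
  ring

theorem derivative_legendre_succ (n : ℕ) :
    derivative (legendre (n + 1)) =
      X * derivative (legendre n) + ((n : ℝ) + 1) • legendre n := by
  rw [derivative_legendre, derivative_legendre, legendre, Function.iterate_succ_apply,
    derivative_sq_sub_one_pow_succ, iterate_derivative_smul, iterate_derivative_mul_X]
  have h : (n.factorial : ℝ) ≠ 0 := by positivity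
  have h' : (n : ℝ) + 1 ≠ 0 := by positivity
  have e : ((2 ^ (n + 1) * (n + 1).factorial : ℝ))⁻¹ * (2 * ((n : ℝ) + 1)) =
      (2 ^ n * n.factorial : ℝ)⁻¹ := by
    rw [Nat.factorial_succ]; push_cast; field_simp; ring
  rw [smul_smul, e, smul_add, mul_comm X, smul_mul_assoc, ← Nat.cast_smul_eq_nsmul ℝ,
    smul_comm ((n : ℝ) + 1)]
  simp

theorem derivative_legendre_add_two (n : ℕ) :
    derivative (legendre (n + 2)) =
      (2 * (n : ℝ) + 3) • legendre (n + 1) + derivative (legendre n) := by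
  rw [derivative_legendre, derivative_legendre, legendre, Function.iterate_succ_apply,
    Function.iterate_succ_apply, derivative_derivative_sq_sub_one_pow, iterate_map_add,
    iterate_derivative_smul, iterate_derivative_smul, smul_add, smul_smul, smul_smul, smul_smul]
  have h : (n.factorial : ℝ) ≠ 0 := by positivity
  have h' : (n : ℝ) + 1 ≠ 0 := by positivity
  have h'' : (n : ℝ) + 2 ≠ 0 := by positivity
  have h3 : (n : ℝ) + 1 + 1 ≠ 0 := by positivity
  congr 2
  · rw [Nat.factorial_succ (n + 1)]; push_cast; field_simp; ring
  · rw [Nat.factorial_succ (n + 1), Nat.factorial_succ n]; push_cast; field_simp; ring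

theorem derivative_legendre_recurrence (n : ℕ) (x : ℝ) :
    ((n : ℝ) + 1) * (derivative (legendre (n + 2))).eval x =
      (2 * (n : ℝ) + 3) * x * (derivative (legendre (n + 1))).eval x -
        ((n : ℝ) + 2) * (derivative (legendre n)).eval x := by
  have h1 := congrArg (eval x) (derivative_legendre_succ (n + 1))
  have h2 := congrArg (eval x) (derivative_legendre_add_two n)
  simp only [eval_add, eval_mul, eval_X, eval_smul, smul_eq_mul] at h1 h2
  push_cast at h1
  linear_combination (2 * (n : ℝ) + 3) * h1 - ((n : ℝ) + 2) * h2

theorem derivative_legendre_zero : derivative (legendre 0) = 0 := by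
  simp [legendre]

theorem derivative_legendre_one : derivative (legendre 1) = 1 := by
  rw [derivative_legendre_succ, derivative_legendre_zero]
  simp [legendre]

theorem A2entry_eq (a : ℝ) (k j : ℕ) :
    A2entry a k j = (if k = j + 1 then ((j : ℝ) + 1) / (2 * (j : ℝ) + 3) * a else 0) +
      (if j = k + 1 then ((k : ℝ) + 3) / (2 * (k : ℝ) + 5) * a else 0) := by
  unfold A2entry
  split_ifs <;> first | omega | simp

theorem sum_mul_A2entry {N : ℕ} {r : ℝ} (a : ℝ)
    (hr : (derivative (legendre (N + 1))).eval r = 0) {j : ℕ} (hj : j < N) :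
    ∑ k ∈ Finset.range N, (derivative (legendre (k + 1))).eval r * A2entry a k j =
      a * r * (derivative (legendre (j + 1))).eval r := by
  rw [← add_zero (∑ k ∈ _, _), ← zero_mul (A2entry a N j), ← hr, ← Finset.sum_range_succ
    (fun k => (derivative (legendre (k + 1))).eval r * A2entry a k j)]
  simp only [A2entry_eq, mul_add, Finset.sum_add_distrib, mul_ite, mul_zero]
  rw [Finset.sum_ite_eq', if_pos (by simpa using hj)]
  have hrec := derivative_legendre_recurrence j r
  have h3 : 2 * (j : ℝ) + 3 ≠ 0 := by positivity
  rcases j with _ | j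
  · rw [Finset.sum_eq_zero (by simp)]
    rw [derivative_legendre_zero] at hrec
    simp at hrec ⊢
    linear_combination a / 3 * hrec
  · simp only [add_left_inj]
    rw [Finset.sum_ite_eq, if_pos (by simp; omega)]
    push_cast at hrec h3 ⊢
    have h5 : 2 * (j : ℝ) + 5 ≠ 0 := by positivity
    have e : 2 * ((j : ℝ) + 1) + 3 = 2 * j + 5 := by ring
    rw [e] at hrec ⊢
    field_simp
    linear_combination a * hrec

namespace Matrix

variable {n : Type*} [Fintype n] [DecidableEq n]

theorem mem_spectrum_of_vecMul_eq {K : Type*} [Field K] {A : Matrix n n K} {μ : K} {v : n → K}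
    (hv : v ≠ 0) (h : v ᵥ* A = μ • v) : μ ∈ spectrum K A := by
  rw [spectrum.mem_iff]
  intro hu
  refine hv (vecMul_injective_of_isUnit hu ?_)
  simp [vecMul_sub, h, Algebra.algebraMap_eq_smul_one, vecMul_smul]

theorem mem_spectrum_of_mulVec_eq {K : Type*} [Field K] {A : Matrix n n K} {μ : K} {v : n → K}
    (hv : v ≠ 0) (h : A *ᵥ v = μ • v) : μ ∈ spectrum K A := by
  rw [spectrum.mem_iff]
  intro hu
  refine hv (mulVec_injective_of_isUnit hu ?_)
  simp [sub_mulVec, h, Algebra.algebraMap_eq_smul_one, smul_mulVec]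

theorem finite_spectrum_and_ncard_le {K : Type*} [Field K] (A : Matrix n n K) :
    (spectrum K A).Finite ∧ (spectrum K A).ncard ≤ Fintype.card n := by
  classical
  have h : spectrum K A = (A.charpoly.roots.toFinset : Set K) := by
    ext μ
    simp [mem_spectrum_iff_isRoot_charpoly, A.charpoly_monic.ne_zero]
  rw [h]
  refine ⟨Finset.finite_toSet _, ?_⟩
  rw [Set.ncard_coe_finset, ← A.charpoly_natDegree_eq_dim]
  exact (Multiset.toFinset_card_le _).trans (card_roots' _)

theorem exists_diagonalization_of_ncard_spectrum {K : Type*} [Field K] (A : Matrix n n K)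
    (h : (spectrum K A).ncard = Fintype.card n) :
    ∃ P D : Matrix n n K, IsUnit P ∧ D.IsDiag ∧ A = P * D * P⁻¹ := by
  have hfin := (finite_spectrum_and_ncard_le A).1
  have := hfin.to_subtype
  let e : n ≃ spectrum K A := (Finite.equivFinOfCardEq (by simpa using h.symm)).trans
    (Finite.equivFin (spectrum K A)).symm
  have hev : ∀ i, ∃ v, Module.End.HasEigenvector (toLin' A) (e i : K) v := fun i =>
    (Module.End.hasEigenvalue_iff_mem_spectrum.2
      (by rw [spectrum_toLin']; exact (e i).2)).exists_hasEigenvector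
  choose v hv using hev
  have hli : LinearIndependent K v := Module.End.eigenvectors_linearIndependent' (toLin' A)
    (fun i => (e i : K)) (Subtype.coe_injective.comp e.injective) v hv
  let P : Matrix n n K := of fun i j => v j i
  have hP : IsUnit P := linearIndependent_cols_iff_isUnit.1 hli
  refine ⟨P, diagonal fun i => (e i : K), hP, isDiag_diagonal _, ?_⟩
  have hAP : A * P = P * diagonal fun i => (e i : K) := by
    ext i j
    have := congrFun (hv j).apply_eq_smul i
    rw [toLin'_apply] at this
    rw [mul_diagonal, mul_comm]
    exact this
  rw [← hAP, mul_nonsing_inv_cancel_right _ _ ((isUnit_iff_isUnit_det P).1 hP)]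

end Matrix

theorem root_mem_spectrum_AMHSWME {N : ℕ} (hN : 2 ≤ N) (g h um : ℝ) (α : ℕ → ℝ) {r : ℝ}
    (hr : (derivative (legendre (N + 1))).eval r = 0) :
    um + α 1 * r ∈ spectrum ℝ (AMHSWME N g h um α) := by
  set q : ℕ → ℝ := fun k => (derivative (legendre (k + 1))).eval r with hq
  have q0 : q 0 = 1 := by simp [hq, derivative_legendre_one]
  have q1 : q 1 = 3 * r := by
    have := derivative_legendre_recurrence 0 r
    simpa [hq, derivative_legendre_zero, derivative_legendre_one] using this
  let v : Fin (N + 2) → ℝ := Fin.cons (-2 * α 1) (Fin.cons 0 fun k => q k)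
  refine Matrix.mem_spectrum_of_vecMul_eq (v := v) ?_ ?_
  · intro hv
    have := congrFun hv (Fin.succ (Fin.succ ⟨0, by omega⟩))
    simp only [v, Fin.cons_succ, q0] at this
    norm_num at this
  · obtain ⟨M, rfl⟩ := Nat.exists_eq_add_of_le' hN
    ext c
    rw [Matrix.vecMul, dotProduct, Fin.sum_univ_succ, Fin.sum_univ_succ]
    refine Fin.cases ?_ (fun c => Fin.cases ?_ (fun c => ?_) c) c
    · rw [Fin.sum_univ_succ, Fin.sum_univ_succ]
      simp [-Fin.succ_zero_eq_one, -Fin.succ_zero_eq_one', v, AMHSWME, q0, q1]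
      ring
    · rw [Fin.sum_univ_succ]
      simp [-Fin.succ_zero_eq_one, -Fin.succ_zero_eq_one', v, AMHSWME, q0]
    · have hs := sum_mul_A2entry (α 1) hr c.2
      rw [← Fin.sum_univ_eq_sum_range
        (fun k => (derivative (legendre (k + 1))).eval r * A2entry (α 1) k c)] at hs
      simp [-Fin.succ_zero_eq_one, -Fin.succ_zero_eq_one', v, AMHSWME, mul_add,
        Finset.sum_add_distrib]
      rw [hs]
      simp [hq]
      ring

theorem velocity_mem_spectrum_AMHSWME {N : ℕ} (hN : 2 ≤ N) (g h um : ℝ) (α : ℕ → ℝ) {μ : ℝ}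
    (hμ : μ ^ 2 = g * h + (α 1) ^ 2 - ∑ i ∈ Finset.Icc 2 N, (α i) ^ 2 / (2 * (i : ℝ) + 1)) :
    um + μ ∈ spectrum ℝ (AMHSWME N g h um α) := by
  have hsum : ∑ i ∈ Finset.Icc 1 N, (α i) ^ 2 / (2 * (i : ℝ) + 1) =
      (α 1) ^ 2 / 3 + ∑ i ∈ Finset.Icc 2 N, (α i) ^ 2 / (2 * (i : ℝ) + 1) := by
    rw [← Finset.insert_Icc_add_one_left_eq_Icc (by omega : 1 ≤ N),
      Finset.sum_insert (by simp)]
    norm_num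
  obtain ⟨M, rfl⟩ := Nat.exists_eq_add_of_le' hN
  let v : Fin (M + 2 + 2) → ℝ :=
    Fin.cons 1 (Fin.cons (um + μ) (Fin.cons (2 * α 1) fun _ => 0))
  refine Matrix.mem_spectrum_of_mulVec_eq (v := v) ?_ ?_
  · intro hv
    have := congrFun hv 0
    simp [v] at this
  · ext c
    rw [Matrix.mulVec, dotProduct, Fin.sum_univ_succ, Fin.sum_univ_succ, Fin.sum_univ_succ]
    refine Fin.cases ?_ (fun c => Fin.cases ?_ (fun c => Fin.cases ?_
      (fun c => Fin.cases ?_ (fun c => ?_) c) c) c) c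
    · simp [-Fin.succ_zero_eq_one, -Fin.succ_zero_eq_one', v, AMHSWME]
    · simp [-Fin.succ_zero_eq_one, -Fin.succ_zero_eq_one', v, AMHSWME, hsum]
      linear_combination -hμ
    · simp [-Fin.succ_zero_eq_one, -Fin.succ_zero_eq_one', v, AMHSWME, A2entry]
      ring
    · simp [-Fin.succ_zero_eq_one, -Fin.succ_zero_eq_one', v, AMHSWME, A2entry]
      ring
    · simp [-Fin.succ_zero_eq_one, -Fin.succ_zero_eq_one', v, AMHSWME, A2entry]

/-- Under `gh > Σ_{i=2}^N α_i²/(2i+1)`, the MHSWME system matrix has `N+2` pairwise distinct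
real eigenvalues: `u_m + α₁·r` for the `N` real roots `r` of `P'_{N+1}`, together with
`u_m ± √(gh + α₁² − Σ_{i=2}^N α_i²/(2i+1))`; in particular it is real diagonalizable. -/
theorem stmt_6 (N : ℕ) (hN : 2 ≤ N) (g h um : ℝ) (α : ℕ → ℝ) (hα1 : α 1 ≠ 0)
    (hgh : ∑ i ∈ Finset.Icc 2 N, (α i) ^ 2 / (2 * (i : ℝ) + 1) < g * h) :
    spectrum ℝ (AMHSWME N g h um α) =
        ((fun r => um + α 1 * r) '' {r : ℝ | (derivative (legendre (N + 1))).eval r = 0}) ∪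
          {um + Real.sqrt (g * h + (α 1) ^ 2 -
              ∑ i ∈ Finset.Icc 2 N, (α i) ^ 2 / (2 * (i : ℝ) + 1)),
            um - Real.sqrt (g * h + (α 1) ^ 2 -
              ∑ i ∈ Finset.Icc 2 N, (α i) ^ 2 / (2 * (i : ℝ) + 1))} ∧
      (spectrum ℝ (AMHSWME N g h um α)).ncard = N + 2 ∧
      ∃ P D : Matrix (Fin (N + 2)) (Fin (N + 2)) ℝ,
        IsUnit P ∧ D.IsDiag ∧ AMHSWME N g h um α = P * D * P⁻¹ := by

  set S := ∑ i ∈ Finset.Icc 2 N, (α i) ^ 2 / (2 * (i : ℝ) + 1) with hS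
  set A := AMHSWME N g h um α
  set s := Real.sqrt (g * h + (α 1) ^ 2 - S)
  have hpos : 0 < g * h - S := sub_pos.2 hgh
  have hsq : s ^ 2 = g * h + (α 1) ^ 2 - S := Real.sq_sqrt (by nlinarith [sq_nonneg (α 1)])
  have hs0 : 0 < s := Real.sqrt_pos.2 (by nlinarith [sq_nonneg (α 1)])
  obtain ⟨t, htc, ht⟩ := exists_roots_derivative_legendre N
  set f : ℝ → ℝ := fun r => um + α 1 * r
  have hf : Function.Injective f := fun x y hxy => mul_left_cancel₀ hα1 (add_left_cancel hxy)
  have hdisj : ∀ x ∈ t, (α 1 * x) ^ 2 ≠ s ^ 2 := by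
    intro x hx he
    obtain ⟨⟨h1, h2⟩, -⟩ := ht x hx
    nlinarith [mul_nonneg (sq_nonneg (α 1)) (show 0 ≤ 1 - x ^ 2 by nlinarith)]
  have hsub : f '' {r : ℝ | (derivative (legendre (N + 1))).eval r = 0} ∪ {um + s, um - s} ⊆
      spectrum ℝ A := by
    rintro x (⟨r, hr, rfl⟩ | rfl | rfl)
    · exact root_mem_spectrum_AMHSWME hN g h um α hr
    · exact velocity_mem_spectrum_AMHSWME hN g h um α hsq
    · rw [sub_eq_add_neg]
      exact velocity_mem_spectrum_AMHSWME hN g h um α (by rw [neg_sq]; exact hsq)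
  obtain ⟨hfin, hle⟩ := A.finite_spectrum_and_ncard_le
  rw [Fintype.card_fin] at hle
  have hcard : N + 2 ≤
      (f '' {r : ℝ | (derivative (legendre (N + 1))).eval r = 0} ∪ {um + s, um - s}).ncard := by
    have hT : (f '' (t : Set ℝ) ∪ {um + s, um - s}).ncard = N + 2 := by
      rw [Set.ncard_union_eq, Set.ncard_image_of_injective _ hf, Set.ncard_coe_finset, htc,
        Set.ncard_pair (by linarith)]
      rw [Set.disjoint_left]
      rintro _ ⟨x, hx, rfl⟩ (he | he)
      · exact hdisj x hx (by rw [add_left_cancel he])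
      · refine hdisj x hx ?_
        have : α 1 * x = -s := by
          have : um + α 1 * x = um - s := he
          linarith
        rw [this, neg_sq]
    rw [← hT]
    exact Set.ncard_le_ncard (Set.union_subset_union_left _
      (Set.image_mono fun x hx => (ht x hx).2)) (hfin.subset hsub)
  have heq := Set.eq_of_subset_of_ncard_le hsub (hle.trans hcard) hfin
  have hN2 : (spectrum ℝ A).ncard = N + 2 := le_antisymm hle (heq ▸ hcard)
  exact ⟨heq.symm, hN2, A.exists_diagonalization_of_ncard_spectrum (by simpa using hN2)⟩
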